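/- arXiv:1709.07098 — 2 statements merged into one kernel-verified Lean document; each statement's English description precedes it below -/
import Mathlib

section
/- Let T, D > 0 and L_g ≥ 0. Let G : (0,T] × [0,D] × [0,D] → [0,∞) be measurable with ∫₀^D G(r,x,y) dy ≤ 1 for every r ∈ (0,T] and x ∈ [0,D], and suppose 𝒢_T := sup_{x∈[0,D]} ∫₀^T ∫₀^D G(t,x,y)² dy dt < ∞. Let g : [0,D] × ℝ → ℝ be measurable with |g(y,u) − g(y,v)| ≤ L_g |u − v| for all y ∈ [0,D] and u, v ∈ ℝ. Let X ∈ L²([0,T] × [0,D]) with ‖X‖²_{T,2} := ∫₀^T ∫₀^D X(s,y)² dy ds. Suppose u, v : [0,T] × [0,D] → ℝ are continuous and satisfy, for every (t,x) ∈ [0,T] × [0,D], u(t,x) − v(t,x) = ∫₀^t ∫₀^D G(t−s, x, y)[g(y, u(s,y)) − g(y, v(s,y))] dy ds + ∫₀^t ∫₀^D G(t−s, x, y) X(s,y) dy ds. Then sup_{(t,x) ∈ [0,T]×[0,D]} |u(t,x) − v(t,x)|² ≤ 2 𝒢_T e^{2 L_g² T²} ‖X‖²_{T,2}. -/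
open MeasureTheory Set

/-- The Cauchy–Schwarz inequality for real-valued square-integrable functions. -/
theorem sq_integral_mul_le {α : Type*} [MeasurableSpace α] {μ : Measure α} {f g : α → ℝ}
    (hf : MemLp f 2 μ) (hg : MemLp g 2 μ) :
    (∫ a, f a * g a ∂μ) ^ 2 ≤ (∫ a, f a ^ 2 ∂μ) * ∫ a, g a ^ 2 ∂μ := by
  have hff := hf.integrable_sq
  have hgg := hg.integrable_sq
  have hfg : Integrable (fun a => f a * g a) μ := hf.integrable_mul hg
  have hquad : ∀ c : ℝ, 0 ≤ (∫ a, g a ^ 2 ∂μ) * (c * c) + (2 * ∫ a, f a * g a ∂μ) * c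
      + ∫ a, f a ^ 2 ∂μ := by
    intro c
    have hexp : ∫ a, (c * g a + f a) ^ 2 ∂μ = (∫ a, g a ^ 2 ∂μ) * (c * c)
        + (2 * ∫ a, f a * g a ∂μ) * c + ∫ a, f a ^ 2 ∂μ := by
      have hfun : (fun a => (c * g a + f a) ^ 2)
          = fun a => (c * c) * g a ^ 2 + (2 * c) * (f a * g a) + f a ^ 2 := by
        funext a; ring
      rw [hfun, integral_add (f := fun a => (c * c) * g a ^ 2 + (2 * c) * (f a * g a))
        ((hgg.const_mul _).add (hfg.const_mul _)) hff,
        integral_add (hgg.const_mul _) (hfg.const_mul _), integral_const_mul, integral_const_mul]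
      ring
    rw [← hexp]
    exact integral_nonneg fun a => sq_nonneg _
  have hdiscrim := discrim_le_zero hquad
  rw [discrim] at hdiscrim
  nlinarith

/-- Reversing time in the first coordinate preserves Lebesgue measure on `(0,t) × S`. -/
theorem measurePreserving_time_reversal (t : ℝ) {S : Set ℝ} :
    MeasurePreserving (fun q : ℝ × ℝ => (t - q.1, q.2))
      ((volume.restrict (Ioo 0 t)).prod (volume.restrict S))
      ((volume.restrict (Ioo 0 t)).prod (volume.restrict S)) := by
  have h := (Measure.measurePreserving_sub_left volume t).restrict_preimage
    (measurableSet_Ioo (a := (0 : ℝ)) (b := t))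
  simp only [preimage_const_sub_Ioo, sub_self, sub_zero] at h
  exact h.prod (MeasurePreserving.id _)

/-- A kernel square-integrable on `(0,T] × S` is, after time reversal at `t ≤ T`, in `L²` of
`(0,t) × S`, with no larger norm. -/
theorem memLp_time_reversal {k : ℝ → ℝ → ℝ} (hk : Measurable fun q : ℝ × ℝ => k q.1 q.2)
    {T t : ℝ} (htT : t ≤ T) {S : Set ℝ}
    (hksq : IntegrableOn (fun q : ℝ × ℝ => k q.1 q.2 ^ 2) (Ioc 0 T ×ˢ S)) :
    MemLp (fun q : ℝ × ℝ => k (t - q.1) q.2) 2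
        ((volume.restrict (Ioo 0 t)).prod (volume.restrict S)) ∧
      ∫ q, k (t - q.1) q.2 ^ 2 ∂((volume.restrict (Ioo 0 t)).prod (volume.restrict S)) ≤
        ∫ r in Ioc 0 T, ∫ y in S, k r y ^ 2 := by
  have hmp := measurePreserving_time_reversal t (S := S)
  have hle : (volume.restrict (Ioo 0 t)).prod (volume.restrict S)
      ≤ (volume.restrict (Ioc 0 T)).prod (volume.restrict S) := by
    refine Measure.prod_mono (Measure.restrict_mono ?_ le_rfl) le_rfl
    exact fun s hs => ⟨hs.1, hs.2.le.trans htT⟩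
  have hint : Integrable (fun q : ℝ × ℝ => k q.1 q.2 ^ 2)
      ((volume.restrict (Ioc 0 T)).prod (volume.restrict S)) := by
    rwa [Measure.prod_restrict]
  refine ⟨?_, ?_⟩
  · have hmem : MemLp (fun q : ℝ × ℝ => k q.1 q.2) 2
        ((volume.restrict (Ioo 0 t)).prod (volume.restrict S)) :=
      (memLp_two_iff_integrable_sq hk.aestronglyMeasurable).2 (hint.mono_measure hle)
    exact hmem.comp_measurePreserving hmp
  · have hcomp := integral_map (μ := (volume.restrict (Ioo 0 t)).prod (volume.restrict S))
      hmp.measurable.aemeasurable (f := fun q : ℝ × ℝ => k q.1 q.2 ^ 2)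
      (hk.pow_const 2).aestronglyMeasurable
    rw [hmp.map_eq] at hcomp
    rw [← hcomp, ← integral_prod _ hint]
    exact integral_mono_measure hle (Filter.Eventually.of_forall fun q => sq_nonneg _) hint

/-- The forcing term of the mild formulation is controlled by the `L²` norms of the kernel and of
the forcing. -/
theorem sq_integral_time_reversal_mul_le {k X : ℝ → ℝ → ℝ}
    (hk : Measurable fun q : ℝ × ℝ => k q.1 q.2) (hX : Measurable fun q : ℝ × ℝ => X q.1 q.2)
    {T t : ℝ} (htT : t ≤ T) {S : Set ℝ}
    (hksq : IntegrableOn (fun q : ℝ × ℝ => k q.1 q.2 ^ 2) (Ioc 0 T ×ˢ S))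
    (hXsq : IntegrableOn (fun q : ℝ × ℝ => X q.1 q.2 ^ 2) (Icc 0 T ×ˢ S)) :
    (∫ s in Ioc 0 t, ∫ y in S, k (t - s) y * X s y) ^ 2 ≤
      (∫ r in Ioc 0 T, ∫ y in S, k r y ^ 2) * ∫ s in Icc 0 T, ∫ y in S, X s y ^ 2 := by
  obtain ⟨hmem, hle⟩ := memLp_time_reversal hk htT hksq
  have hmeas : (volume.restrict (Ioo 0 t)).prod (volume.restrict S)
      ≤ (volume.restrict (Icc 0 T)).prod (volume.restrict S) := by
    refine Measure.prod_mono (Measure.restrict_mono ?_ le_rfl) le_rfl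
    exact fun s hs => ⟨hs.1.le, hs.2.le.trans htT⟩
  have hXint : Integrable (fun q : ℝ × ℝ => X q.1 q.2 ^ 2)
      ((volume.restrict (Icc 0 T)).prod (volume.restrict S)) := by
    rwa [Measure.prod_restrict]
  have hXmem : MemLp (fun q : ℝ × ℝ => X q.1 q.2) 2
      ((volume.restrict (Ioo 0 t)).prod (volume.restrict S)) :=
    (memLp_two_iff_integrable_sq hX.aestronglyMeasurable).2 (hXint.mono_measure hmeas)
  rw [← restrict_Ioo_eq_restrict_Ioc, ← integral_prod _ hXint,
    ← integral_prod (fun q : ℝ × ℝ => k (t - q.1) q.2 * X q.1 q.2) (hmem.integrable_mul hXmem)]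
  refine (sq_integral_mul_le hmem hXmem).trans ?_
  refine mul_le_mul hle ?_ (integral_nonneg fun q => sq_nonneg _)
    (integral_nonneg fun r => integral_nonneg fun y => sq_nonneg _)
  exact integral_mono_measure hmeas (Filter.Eventually.of_forall fun q => sq_nonneg _) hXint

/-- A sub-Markovian kernel maps a function bounded by `b s` in space at time `s` to one whose
square is bounded by `t ∫₀ᵗ b²`. -/
theorem sq_integral_time_reversal_mul_le_of_abs_le {k f : ℝ → ℝ → ℝ}
    (hk : Measurable fun q : ℝ × ℝ => k q.1 q.2) {T t : ℝ} (ht : 0 ≤ t) (htT : t ≤ T)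
    {S : Set ℝ} (hS : MeasurableSet S) (hSfin : volume S ≠ ⊤)
    (hksq : IntegrableOn (fun q : ℝ × ℝ => k q.1 q.2 ^ 2) (Ioc 0 T ×ˢ S))
    (hk0 : ∀ r ∈ Ioc 0 T, ∀ y ∈ S, 0 ≤ k r y) (hk1 : ∀ r ∈ Ioc 0 T, ∫ y in S, k r y ≤ 1)
    {b : ℝ → ℝ} (hb : Continuous b) (hfb : ∀ s ∈ Icc 0 T, ∀ y ∈ S, |f s y| ≤ b s)
    (hb0 : ∀ s, 0 ≤ b s) :
    (∫ s in Ioc 0 t, ∫ y in S, k (t - s) y * f s y) ^ 2 ≤ t * ∫ s in (0 : ℝ)..t, b s ^ 2 := by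
  have : IsFiniteMeasure (volume.restrict S) := ⟨by simpa using hSfin.lt_top⟩
  obtain ⟨hmem, -⟩ := memLp_time_reversal hk htT hksq
  have hbint : ∀ {c : ℝ → ℝ}, Continuous c → Integrable c (volume.restrict (Ioo 0 t)) :=
    fun hc => (hc.integrableOn_Icc (a := 0) (b := t)).mono_set Ioo_subset_Icc_self
  have hae : ∀ᵐ s ∂volume.restrict (Ioo 0 t), ‖∫ y in S, k (t - s) y * f s y‖ ≤ b s := by
    filter_upwards [hmem.integrable_sq.prod_right_ae, ae_restrict_mem measurableSet_Ioo]
      with s hs hst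
    have hr : t - s ∈ Ioc 0 T := ⟨by linarith [hst.2], by linarith [hst.1]⟩
    have hslice : Measurable fun y => k (t - s) y := hk.comp measurable_prodMk_left
    have hks : Integrable (fun y => k (t - s) y) (volume.restrict S) :=
      ((memLp_two_iff_integrable_sq hslice.aestronglyMeasurable).2 hs).integrable one_le_two
    calc ‖∫ y in S, k (t - s) y * f s y‖ ≤ ∫ y in S, k (t - s) y * b s := by
          refine norm_integral_le_of_norm_le (hks.mul_const _) ?_
          filter_upwards [ae_restrict_mem hS] with y hy
          rw [Real.norm_eq_abs, abs_mul, abs_of_nonneg (hk0 _ hr y hy)]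
          exact mul_le_mul_of_nonneg_left
            (hfb s ⟨hst.1.le, hst.2.le.trans htT⟩ y hy) (hk0 _ hr y hy)
      _ = (∫ y in S, k (t - s) y) * b s := integral_mul_const _ _
      _ ≤ b s := mul_le_of_le_one_left (hb0 s) (hk1 _ hr)
  rw [intervalIntegral.integral_of_le ht, ← restrict_Ioo_eq_restrict_Ioc]
  have hbmem : MemLp b 2 (volume.restrict (Ioo 0 t)) :=
    (memLp_two_iff_integrable_sq hb.aestronglyMeasurable).2 (hbint (hb.pow 2))
  have hcs := sq_integral_mul_le (memLp_const (1 : ℝ)) hbmem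
  simp only [one_mul, one_pow, integral_const, measureReal_restrict_apply_univ,
    Real.volume_real_Ioo_of_le ht, sub_zero, smul_eq_mul, mul_one] at hcs
  refine le_trans ?_ hcs
  exact sq_le_sq' (neg_le_of_abs_le (norm_integral_le_of_norm_le (hbint hb) hae))
    (le_of_abs_le (norm_integral_le_of_norm_le (hbint hb) hae))

/-- Deterministic core of Theorem 1 (TCI for the stochastic heat equation with
additive noise): if `G` is a nonnegative measurable kernel with mass at most one
and `𝒢_T := sup_{x ∈ [0,D]} ∫₀^T ∫₀^D G(t,x,y)² dy dt < ∞`, `g` is Lipschitz in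
its last variable with constant `L_g`, `X ∈ L²([0,T]×[0,D])` and the continuous
functions `u, v` satisfy the coupled integral equation, then
`sup |u - v|² ≤ 2 𝒢_T e^{2 L_g² T²} ‖X‖²_{T,2}`. -/
theorem coupled_heat_additive_bound
    (T D Lg : ℝ) (hT : 0 < T) (hD : 0 < D) (hLg : 0 ≤ Lg)
    (G : ℝ → ℝ → ℝ → ℝ)
    (hGmeas : Measurable fun q : ℝ × ℝ × ℝ => G q.1 q.2.1 q.2.2)
    (hGnonneg : ∀ t ∈ Ioc (0 : ℝ) T, ∀ x ∈ Icc (0 : ℝ) D, ∀ y ∈ Icc (0 : ℝ) D,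
      0 ≤ G t x y)
    (hGmass : ∀ r ∈ Ioc (0 : ℝ) T, ∀ x ∈ Icc (0 : ℝ) D,
      ∫ y in Icc (0 : ℝ) D, G r x y ≤ 1)
    (hGsq : ∀ x ∈ Icc (0 : ℝ) D,
      IntegrableOn (fun q : ℝ × ℝ => (G q.1 x q.2) ^ 2) (Ioc 0 T ×ˢ Icc 0 D))
    (GT : ℝ)
    (hGT : GT = sSup ((fun x => ∫ t in Ioc (0 : ℝ) T, ∫ y in Icc (0 : ℝ) D,
      (G t x y) ^ 2) '' Icc (0 : ℝ) D))
    (hGTbdd : BddAbove ((fun x => ∫ t in Ioc (0 : ℝ) T, ∫ y in Icc (0 : ℝ) D,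
      (G t x y) ^ 2) '' Icc (0 : ℝ) D))
    (g : ℝ → ℝ → ℝ)
    (hgmeas : Measurable fun q : ℝ × ℝ => g q.1 q.2)
    (hgLip : ∀ y ∈ Icc (0 : ℝ) D, ∀ w z : ℝ, |g y w - g y z| ≤ Lg * |w - z|)
    (X : ℝ → ℝ → ℝ)
    (hXmeas : Measurable fun q : ℝ × ℝ => X q.1 q.2)
    (hXL2 : IntegrableOn (fun q : ℝ × ℝ => (X q.1 q.2) ^ 2) (Icc 0 T ×ˢ Icc 0 D))
    (normX2 : ℝ)
    (hnormX2 : normX2 = ∫ s in Icc (0 : ℝ) T, ∫ y in Icc (0 : ℝ) D, (X s y) ^ 2)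
    (u v : ℝ → ℝ → ℝ)
    (hu : ContinuousOn (fun q : ℝ × ℝ => u q.1 q.2) (Icc 0 T ×ˢ Icc 0 D))
    (hv : ContinuousOn (fun q : ℝ × ℝ => v q.1 q.2) (Icc 0 T ×ˢ Icc 0 D))
    (huv : ∀ t ∈ Icc (0 : ℝ) T, ∀ x ∈ Icc (0 : ℝ) D,
      u t x - v t x =
        (∫ s in Ioc (0 : ℝ) t, ∫ y in Icc (0 : ℝ) D,
          G (t - s) x y * (g y (u s y) - g y (v s y)))
        + ∫ s in Ioc (0 : ℝ) t, ∫ y in Icc (0 : ℝ) D, G (t - s) x y * X s y) :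
    ∀ t ∈ Icc (0 : ℝ) T, ∀ x ∈ Icc (0 : ℝ) D,
      (u t x - v t x) ^ 2 ≤ 2 * GT * Real.exp (2 * Lg ^ 2 * T ^ 2) * normX2 := by
  set a : ℝ := 2 * Lg ^ 2 * T with ha
  have hGx : ∀ x, Measurable fun q : ℝ × ℝ => G q.1 x q.2 := fun x =>
    hGmeas.comp (measurable_fst.prodMk (measurable_const.prodMk measurable_snd))
  have hX0 : 0 ≤ normX2 :=
    hnormX2 ▸ integral_nonneg fun s => integral_nonneg fun y => sq_nonneg _
  have hGTx : ∀ x ∈ Icc (0 : ℝ) D, ∫ t in Ioc (0 : ℝ) T, ∫ y in Icc (0 : ℝ) D, (G t x y) ^ 2 ≤ GT :=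
    fun x hx => hGT ▸ le_csSup hGTbdd (mem_image_of_mem _ hx)
  have hGT0 : 0 ≤ GT :=
    (integral_nonneg fun t => integral_nonneg fun y => sq_nonneg _).trans
      (hGTx 0 ⟨le_rfl, hD.le⟩)
  -- Maximising the exponentially weighted squared difference replaces Gronwall's inequality.
  obtain ⟨⟨t₀, x₀⟩, ⟨ht₀, hx₀⟩, hmax⟩ :=
    (isCompact_Icc.prod isCompact_Icc).exists_isMaxOn
      (⟨(0, 0), ⟨le_rfl, hT.le⟩, ⟨le_rfl, hD.le⟩⟩ : (Icc (0 : ℝ) T ×ˢ Icc (0 : ℝ) D).Nonempty)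
      (f := fun q : ℝ × ℝ => (u q.1 q.2 - v q.1 q.2) ^ 2 * Real.exp (-(a * q.1)))
      (((hu.sub hv).pow 2).mul (by fun_prop))
  simp only at ht₀ hx₀
  set K : ℝ := (u t₀ x₀ - v t₀ x₀) ^ 2 * Real.exp (-(a * t₀)) with hK
  have hK0 : 0 ≤ K := by positivity
  have hw : ∀ t ∈ Icc (0 : ℝ) T, ∀ x ∈ Icc (0 : ℝ) D,
      (u t x - v t x) ^ 2 ≤ K * Real.exp (a * t) := by
    intro t ht x hx
    have h : (u t x - v t x) ^ 2 * Real.exp (-(a * t)) ≤ K := hmax (mk_mem_prod ht hx)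
    rwa [Real.exp_neg, ← div_eq_mul_inv, div_le_iff₀ (Real.exp_pos _)] at h
  have hdrift := sq_integral_time_reversal_mul_le_of_abs_le (hGx x₀) ht₀.1 ht₀.2
    measurableSet_Icc (by simp) (hGsq x₀ hx₀) (fun r hr => hGnonneg r hr x₀ hx₀)
    (fun r hr => hGmass r hr x₀ hx₀)
    (f := fun s y => g y (u s y) - g y (v s y))
    (b := fun s => Lg * √(K * Real.exp (a * s))) (by fun_prop)
    (fun s hs y hy => (hgLip y hy _ _).trans
      (mul_le_mul_of_nonneg_left (Real.abs_le_sqrt (hw s hs y hy)) hLg))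
    (fun s => by positivity)
  have hforce := sq_integral_time_reversal_mul_le (k := fun r y => G r x₀ y)
    (hGx x₀) hXmeas ht₀.2 (hGsq x₀ hx₀) hXL2
  have hexp : a * ∫ s in (0 : ℝ)..t₀, Real.exp (a * s) = Real.exp (a * t₀) - 1 := by
    simp [intervalIntegral.mul_integral_comp_mul_left]
  have hint0 : 0 ≤ ∫ s in (0 : ℝ)..t₀, Real.exp (a * s) :=
    intervalIntegral.integral_nonneg ht₀.1 fun s _ => (Real.exp_pos _).le
  have hsq : ∫ s in (0 : ℝ)..t₀, (Lg * √(K * Real.exp (a * s))) ^ 2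
      = Lg ^ 2 * K * ∫ s in (0 : ℝ)..t₀, Real.exp (a * s) := by
    rw [← intervalIntegral.integral_const_mul]
    congr 1
    funext s
    rw [mul_pow, Real.sq_sqrt (by positivity), ← mul_assoc]
  have hdrift' : 2 * (t₀ * ∫ s in (0 : ℝ)..t₀, (Lg * √(K * Real.exp (a * s))) ^ 2)
      ≤ K * (Real.exp (a * t₀) - 1) := by
    rw [hsq, ← hexp, ha]
    have := mul_le_mul_of_nonneg_right ht₀.2
      (mul_nonneg (mul_nonneg (sq_nonneg Lg) hK0) hint0)
    rw [ha] at this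
    linarith
  have hforce' := hforce.trans (mul_le_mul_of_nonneg_right (hGTx x₀ hx₀) (hnormX2 ▸ hX0))
  rw [← hnormX2] at hforce'
  have hKw : (u t₀ x₀ - v t₀ x₀) ^ 2 = K * Real.exp (a * t₀) := by
    rw [hK, mul_assoc, ← Real.exp_add, neg_add_cancel, Real.exp_zero, mul_one]
  have hKle : K ≤ 2 * GT * normX2 := by
    have hadd := add_sq_le (a := ∫ s in Ioc (0 : ℝ) t₀, ∫ y in Icc (0 : ℝ) D,
        G (t₀ - s) x₀ y * (g y (u s y) - g y (v s y)))
      (b := ∫ s in Ioc (0 : ℝ) t₀, ∫ y in Icc (0 : ℝ) D, G (t₀ - s) x₀ y * X s y)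
    rw [← huv t₀ ht₀ x₀ hx₀, hKw] at hadd
    linarith
  intro t ht x hx
  have hmono : Real.exp (a * t) ≤ Real.exp (2 * Lg ^ 2 * T ^ 2) := by
    refine Real.exp_le_exp.2 ?_
    have := mul_le_mul_of_nonneg_left ht.2 (by positivity : 0 ≤ a)
    rw [ha] at this ⊢
    linarith
  calc (u t x - v t x) ^ 2 ≤ K * Real.exp (a * t) := hw t ht x hx
    _ ≤ 2 * GT * normX2 * Real.exp (2 * Lg ^ 2 * T ^ 2) :=
      mul_le_mul hKle hmono (Real.exp_pos _).le (by positivity)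
    _ = 2 * GT * Real.exp (2 * Lg ^ 2 * T ^ 2) * normX2 := by ring
end

section
/- Let T > 0, α ∈ (1,2), and let β be the conjugate exponent, 1/α + 1/β = 1. Let H : (0,T] → [0,∞) be measurable with 𝒢_{T,α} := ∫₀^T H(t)^α dt < ∞, and let m : [0,T] → [0,∞) be bounded and measurable. Suppose there are constants a, b, c ≥ 0 such that for all t ∈ [0,T], m(t) ≤ a ∫₀^t H(t−s) m(s) ds + b ∫₀^t m(s) ds + c. Then m(T)^β ≤ 3^{β−1} c^β · exp( 3^{β−1} ( a^β 𝒢_{T,α}^{β/α} + b^β T^{β/α} ) T ). -/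
open MeasureTheory Set

/-- **Grönwall's inequality** in integral form for an integrable function. -/
theorem le_mul_exp_of_le_add_mul_integral {u : ℝ → ℝ} {T A K : ℝ} (hT : 0 ≤ T) (hK : 0 ≤ K)
    (hu : IntegrableOn u (Ioc 0 T))
    (h : ∀ t ∈ Icc (0 : ℝ) T, u t ≤ A + K * ∫ s in Ioc (0 : ℝ) t, u s) :
    u T ≤ A * Real.exp (K * T) := by
  set u₀ : ℝ → ℝ := (Ioc 0 T).indicator u with hu₀
  have hu₀_int : Integrable u₀ := (integrable_indicator_iff measurableSet_Ioc).2 hu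
  set v : ℝ → ℝ := fun t => A + K * ∫ s in (0 : ℝ)..t, u₀ s with hv
  have hv_cont : Continuous v :=
    continuous_const.add (continuous_const.mul
      (intervalIntegral.continuous_primitive (fun _ _ => hu₀_int.intervalIntegrable) 0))
  set w : ℝ → ℝ := fun t => A + K * ∫ s in (0 : ℝ)..t, v s with hw
  have hw_deriv (t : ℝ) : HasDerivAt w (K * v t) t :=
    ((intervalIntegral.integral_hasDerivAt_right (hv_cont.intervalIntegrable _ _)
      hv_cont.stronglyMeasurable.stronglyMeasurableAtFilter hv_cont.continuousAt).const_mul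
      K).const_add A
  have hle_v {t : ℝ} (ht : t ∈ Icc (0 : ℝ) T) : u t ≤ v t := by
    refine (h t ht).trans_eq ?_
    simp only [hv]
    rw [intervalIntegral.integral_of_le ht.1]
    congr 2
    refine setIntegral_congr_fun measurableSet_Ioc fun s hs => ?_
    have hs' : s ∈ Ioc 0 T := ⟨hs.1, hs.2.trans ht.2⟩
    simp only [hu₀]
    rw [indicator_of_mem hs']
  have hv_le {t : ℝ} (ht : t ∈ Icc (0 : ℝ) T) : v t ≤ w t := by
    refine add_le_add_right (mul_le_mul_of_nonneg_left ?_ hK) A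
    refine intervalIntegral.integral_mono_on_of_le_Ioo ht.1 hu₀_int.intervalIntegrable
      (hv_cont.intervalIntegrable _ _) fun s hs => ?_
    have hs' : s ∈ Ioc 0 T := ⟨hs.1, hs.2.le.trans ht.2⟩
    simp only [hu₀]
    rw [indicator_of_mem hs']
    exact hle_v (Ioc_subset_Icc_self hs')
  have hw_le := le_gronwallBound_of_liminf_deriv_right_le (f := w) (f' := fun t => K * v t)
    (δ := A) (K := K) (ε := 0) (a := 0) (b := T)
    (fun t _ => (hw_deriv t).continuousAt.continuousWithinAt)
    (fun t _ _ hr => (hw_deriv t).hasDerivWithinAt.liminf_right_slope_le hr)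
    (by simp [hw])
    (fun t ht => by
      rw [add_zero]
      exact mul_le_mul_of_nonneg_left (hv_le (Ico_subset_Icc_self ht)) hK)
    T (right_mem_Icc.2 hT)
  rw [gronwallBound_ε0, sub_zero] at hw_le
  exact ((hle_v (right_mem_Icc.2 hT)).trans (hv_le (right_mem_Icc.2 hT))).trans hw_le

/-- Hölder's inequality for nonnegative functions, raised to the power of the second exponent. -/
theorem rpow_integral_mul_le {X : Type*} [MeasurableSpace X] {μ : Measure X} {p q : ℝ}
    (hpq : p.HolderConjugate q) {f g : X → ℝ} (hf_nonneg : 0 ≤ᵐ[μ] f) (hg_nonneg : 0 ≤ᵐ[μ] g)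
    (hf : MemLp f (ENNReal.ofReal p) μ) (hg : MemLp g (ENNReal.ofReal q) μ) :
    (∫ x, f x * g x ∂μ) ^ q ≤ (∫ x, f x ^ p ∂μ) ^ (q / p) * ∫ x, g x ^ q ∂μ := by
  have hF : 0 ≤ ∫ x, f x ^ p ∂μ :=
    integral_nonneg_of_ae (hf_nonneg.mono fun x hx => Real.rpow_nonneg hx p)
  have hG : 0 ≤ ∫ x, g x ^ q ∂μ :=
    integral_nonneg_of_ae (hg_nonneg.mono fun x hx => Real.rpow_nonneg hx q)
  have hFG : 0 ≤ ∫ x, f x * g x ∂μ :=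
    integral_nonneg_of_ae (by
      filter_upwards [hf_nonneg, hg_nonneg] with x hx hy using mul_nonneg hx hy)
  calc (∫ x, f x * g x ∂μ) ^ q
      ≤ ((∫ x, f x ^ p ∂μ) ^ (1 / p) * (∫ x, g x ^ q ∂μ) ^ (1 / q)) ^ q :=
        Real.rpow_le_rpow hFG
          (integral_mul_le_Lp_mul_Lq_of_nonneg hpq hf_nonneg hg_nonneg hf hg) hpq.symm.nonneg
    _ = (∫ x, f x ^ p ∂μ) ^ (q / p) * ∫ x, g x ^ q ∂μ := by
        rw [Real.mul_rpow (by positivity) (by positivity), ← Real.rpow_mul hF, ← Real.rpow_mul hG,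
          one_div_mul_cancel hpq.symm.ne_zero, Real.rpow_one, one_div_mul_eq_div]

theorem rpow_add_add_le {x y z p : ℝ} (hp : 1 ≤ p) (hx : 0 ≤ x) (hy : 0 ≤ y) (hz : 0 ≤ z) :
    (x + y + z) ^ p ≤ 3 ^ (p - 1) * (x ^ p + y ^ p + z ^ p) := by
  simpa [Fin.sum_univ_three] using
    Real.rpow_sum_le_const_mul_sum_rpow_of_nonneg Finset.univ (f := ![x, y, z]) hp
      (fun i _ => by fin_cases i <;> simpa)

/-- The `q`-th power of a convolution is controlled by the `L^p` norm of the kernel. -/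
theorem rpow_integral_comp_sub_mul_le {H m : ℝ → ℝ} {p q t T : ℝ} (hpq : p.HolderConjugate q)
    (ht : t ∈ Icc 0 T) (hH : Measurable H) (hH_nonneg : ∀ s ∈ Ioc (0 : ℝ) T, 0 ≤ H s)
    (hHp : IntegrableOn (fun s => H s ^ p) (Ioc 0 T))
    (hm_nonneg : 0 ≤ᵐ[volume.restrict (Ioc 0 t)] m)
    (hm : MemLp m (ENNReal.ofReal q) (volume.restrict (Ioc 0 t))) :
    0 ≤ ∫ s in Ioc (0 : ℝ) t, H (t - s) * m s ∧
    (∫ s in Ioc (0 : ℝ) t, H (t - s) * m s) ^ q ≤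
      (∫ s in Ioc (0 : ℝ) T, H s ^ p) ^ (q / p) * ∫ s in Ioc (0 : ℝ) t, m s ^ q := by
  have hsub : Ioc 0 t ⊆ Ioc 0 T := Ioc_subset_Ioc_right ht.2
  have hk_nonneg : ∀ᵐ s ∂volume.restrict (Ioc 0 t), 0 ≤ H (t - s) := by
    rw [← restrict_Ioo_eq_restrict_Ioc]
    filter_upwards [ae_restrict_mem measurableSet_Ioo] with s hs
    exact hH_nonneg _ ⟨by linarith [hs.2], by linarith [hs.1, ht.2]⟩
  have hk_int : IntegrableOn (fun s => H (t - s) ^ p) (Ioc 0 t) := by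
    have := ((intervalIntegrable_iff_integrableOn_Ioc_of_le ht.1).2
      (hHp.mono_set hsub)).comp_sub_left t
    rw [sub_zero, sub_self] at this
    exact (intervalIntegrable_iff_integrableOn_Ioc_of_le ht.1).1 this.symm
  have hk : MemLp (fun s => H (t - s)) (ENNReal.ofReal p) (volume.restrict (Ioc 0 t)) := by
    have hk_meas : Measurable fun s => H (t - s) := hH.comp (measurable_const.sub measurable_id)
    rw [← integrable_norm_rpow_iff hk_meas.aestronglyMeasurable
      (by simpa using hpq.pos) ENNReal.ofReal_ne_top, ENNReal.toReal_ofReal hpq.nonneg]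
    refine hk_int.congr ?_
    filter_upwards [hk_nonneg] with s hs
    rw [Real.norm_of_nonneg hs]
  have hk_integral : ∫ s in Ioc (0 : ℝ) t, H (t - s) ^ p = ∫ s in Ioc (0 : ℝ) t, H s ^ p := by
    rw [← intervalIntegral.integral_of_le ht.1, ← intervalIntegral.integral_of_le ht.1,
      intervalIntegral.integral_comp_sub_left (fun s => H s ^ p), sub_zero, sub_self]
  refine ⟨integral_nonneg_of_ae ?_, (rpow_integral_mul_le hpq hk_nonneg hm_nonneg hk hm).trans ?_⟩
  · filter_upwards [hk_nonneg, hm_nonneg] with s hs hs' using mul_nonneg hs hs'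
  rw [hk_integral]
  refine mul_le_mul_of_nonneg_right (Real.rpow_le_rpow ?_ ?_ ?_) ?_
  · exact setIntegral_nonneg measurableSet_Ioc fun s hs =>
      Real.rpow_nonneg (hH_nonneg s (hsub hs)) p
  · refine setIntegral_mono_set hHp ?_ hsub.eventuallyLE
    filter_upwards [ae_restrict_mem measurableSet_Ioc] with s hs
    exact Real.rpow_nonneg (hH_nonneg s hs) p
  · exact div_nonneg hpq.symm.nonneg hpq.nonneg
  · exact integral_nonneg_of_ae (hm_nonneg.mono fun s hs => Real.rpow_nonneg hs q)

/-- Gronwall-type lemma with an `L^α` convolution kernel: let `α ∈ (1,2)` and `β`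
be its conjugate exponent, let `H : (0,T] → [0,∞)` be measurable with
`𝒢_{T,α} := ∫₀^T H(t)^α dt < ∞`, and let `m : [0,T] → [0,∞)` be bounded and
measurable. If `m(t) ≤ a ∫₀^t H(t−s) m(s) ds + b ∫₀^t m(s) ds + c` on `[0,T]`
for constants `a, b, c ≥ 0`, then
`m(T)^β ≤ 3^{β−1} c^β exp(3^{β−1}(a^β 𝒢_{T,α}^{β/α} + b^β T^{β/α}) T)`. -/
theorem gronwall_convolution_kernel
    (T α β a b c : ℝ) (hT : 0 < T) (hα : 1 < α) (hα2 : α < 2)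
    (hconj : 1 / α + 1 / β = 1)
    (ha : 0 ≤ a) (hb : 0 ≤ b) (hc : 0 ≤ c)
    (H : ℝ → ℝ) (hHmeas : Measurable H)
    (hHnonneg : ∀ s ∈ Ioc (0 : ℝ) T, 0 ≤ H s)
    (hHα : IntegrableOn (fun t => H t ^ α) (Ioc 0 T))
    (GTα : ℝ) (hGTα : GTα = ∫ t in Ioc (0 : ℝ) T, H t ^ α)
    (m : ℝ → ℝ) (hmmeas : Measurable m)
    (hmnonneg : ∀ t ∈ Icc (0 : ℝ) T, 0 ≤ m t)
    (hmbdd : ∃ M : ℝ, ∀ t ∈ Icc (0 : ℝ) T, m t ≤ M)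
    (hm : ∀ t ∈ Icc (0 : ℝ) T,
      m t ≤ a * (∫ s in Ioc (0 : ℝ) t, H (t - s) * m s)
            + b * (∫ s in Ioc (0 : ℝ) t, m s) + c) :
    m T ^ β ≤ (3 : ℝ) ^ (β - 1) * c ^ β *
      Real.exp ((3 : ℝ) ^ (β - 1) * (a ^ β * GTα ^ (β / α) + b ^ β * T ^ (β / α)) * T) := by
  have hpq : α.HolderConjugate β := by
    refine Real.holderConjugate_iff.2 ⟨hα, by simpa using hconj⟩
  obtain ⟨M, hM⟩ := hmbdd
  have hm_nonneg {t : ℝ} (ht : t ∈ Icc 0 T) : 0 ≤ᵐ[volume.restrict (Ioc 0 t)] m := by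
    filter_upwards [ae_restrict_mem measurableSet_Ioc] with s hs
    exact hmnonneg s ⟨hs.1.le, hs.2.trans ht.2⟩
  have hm_memLp {t : ℝ} (ht : t ∈ Icc 0 T) :
      MemLp m (ENNReal.ofReal β) (volume.restrict (Ioc 0 t)) := by
    refine MemLp.of_bound hmmeas.aestronglyMeasurable M ?_
    filter_upwards [ae_restrict_mem measurableSet_Ioc] with s hs
    have hs' : s ∈ Icc 0 T := ⟨hs.1.le, hs.2.trans ht.2⟩
    rw [Real.norm_of_nonneg (hmnonneg s hs')]
    exact hM s hs'
  have hG : 0 ≤ GTα := hGTα ▸ setIntegral_nonneg measurableSet_Ioc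
    fun s hs => Real.rpow_nonneg (hHnonneg s hs) α
  have hT_mem : T ∈ Icc 0 T := right_mem_Icc.2 hT.le
  refine le_mul_exp_of_le_add_mul_integral (u := fun t => m t ^ β) hT.le (by positivity) ?_ ?_
  · have h_int := (hm_memLp hT_mem).integrable_norm_rpow
      (by simpa using hpq.symm.pos) ENNReal.ofReal_ne_top
    rw [ENNReal.toReal_ofReal hpq.symm.nonneg] at h_int
    refine h_int.congr ?_
    filter_upwards [hm_nonneg hT_mem] with s hs
    rw [Real.norm_of_nonneg hs]
  intro t ht
  obtain ⟨hX, hXβ⟩ := rpow_integral_comp_sub_mul_le hpq ht hHmeas hHnonneg hHα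
    (hm_nonneg ht) (hm_memLp ht)
  obtain ⟨hY, hYβ⟩ := rpow_integral_comp_sub_mul_le (H := fun _ => 1) hpq ht measurable_const
    (fun _ _ => zero_le_one) (by simp) (hm_nonneg ht) (hm_memLp ht)
  simp only [one_mul, Real.one_rpow, setIntegral_const, Real.volume_real_Ioc_of_le hT.le, sub_zero,
    smul_eq_mul, mul_one] at hY hYβ
  rw [← hGTα] at hXβ
  have haX := mul_le_mul_of_nonneg_left hXβ (Real.rpow_nonneg ha β)
  have hbY := mul_le_mul_of_nonneg_left hYβ (Real.rpow_nonneg hb β)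
  have h3 := (Real.rpow_le_rpow (hmnonneg t ht) (hm t ht) hpq.symm.nonneg).trans
    (rpow_add_add_le hpq.symm.lt.le (mul_nonneg ha hX) (mul_nonneg hb hY) hc)
  rw [Real.mul_rpow ha hX, Real.mul_rpow hb hY] at h3
  refine (h3.trans (mul_le_mul_of_nonneg_left
    (add_le_add_left (add_le_add haX hbY) (c ^ β)) (by positivity))).trans_eq ?_
  ring
end
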